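/- (Theorem 3.1, first bound, explicit constants.) Let A = M + K with A and M invertible n×n real matrices, b ∈ ℝⁿ with b ≠ 0, x := A⁻¹b, B := I + M⁻¹K, and c := M⁻¹b. Let ε ≥ 0 and suppose: E is an n×n matrix with ‖E‖ ≤ ε·(1 + ‖M⁻¹‖·‖K‖) and B̂ := B + E; ĉ ∈ ℝⁿ satisfies ‖ĉ − c‖ ≤ ε·‖M⁻¹‖·‖b‖; F is an n×n matrix with ‖F‖ ≤ ε·‖B̂‖; x̂ ∈ ℝⁿ satisfies (B̂ + F)x̂ = ĉ; and δ := (‖E‖ + ‖F‖)·‖B⁻¹‖ < 1. Then ‖x̂ − x‖ ≤ (2ε/(1 − δ))·κ(B)·(4 + ‖K‖·‖x‖/‖b‖)·‖A⁻¹‖·‖b‖. -/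

import Mathlib

open Matrix

/-- Euclidean norm of a vector in `ℝⁿ`. -/
noncomputable def vnorm {n : ℕ} (v : Fin n → ℝ) : ℝ :=
  ‖(WithLp.equiv 2 (Fin n → ℝ)).symm v‖

/-- Operator norm (spectral norm) of a matrix, induced by the Euclidean norm. -/
noncomputable def opnorm {n : ℕ} (A : Matrix (Fin n) (Fin n) ℝ) : ℝ :=
  ‖Matrix.toEuclideanCLM (𝕜 := ℝ) A‖

/-- Condition number `κ(A) = ‖A‖·‖A⁻¹‖` with respect to the spectral norm. -/
noncomputable def condNum {n : ℕ} (A : Matrix (Fin n) (Fin n) ℝ) : ℝ :=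
  opnorm A * opnorm A⁻¹


lemma vnorm_nonneg {n : ℕ} (v : Fin n → ℝ) : 0 ≤ vnorm v := norm_nonneg _

lemma vnorm_add_le {n : ℕ} (v w : Fin n → ℝ) : vnorm (v + w) ≤ vnorm v + vnorm w :=
  norm_add_le (WithLp.toLp 2 v) (WithLp.toLp 2 w)

lemma vnorm_sub_le {n : ℕ} (v w : Fin n → ℝ) : vnorm (v - w) ≤ vnorm v + vnorm w :=
  norm_sub_le (WithLp.toLp 2 v) (WithLp.toLp 2 w)

lemma vnorm_pos {n : ℕ} {v : Fin n → ℝ} (hv : v ≠ 0) : 0 < vnorm v := by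
  simpa [vnorm] using hv

lemma opnorm_nonneg {n : ℕ} (A : Matrix (Fin n) (Fin n) ℝ) : 0 ≤ opnorm A := norm_nonneg _

lemma opnorm_add_le {n : ℕ} (A B : Matrix (Fin n) (Fin n) ℝ) :
    opnorm (A + B) ≤ opnorm A + opnorm B := by
  simpa [opnorm] using norm_add_le
    (Matrix.toEuclideanCLM (𝕜 := ℝ) A) (Matrix.toEuclideanCLM (𝕜 := ℝ) B)

lemma opnorm_sub_le {n : ℕ} (A B : Matrix (Fin n) (Fin n) ℝ) :
    opnorm (A - B) ≤ opnorm A + opnorm B := by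
  simpa [opnorm] using norm_sub_le
    (Matrix.toEuclideanCLM (𝕜 := ℝ) A) (Matrix.toEuclideanCLM (𝕜 := ℝ) B)

lemma opnorm_mul_le {n : ℕ} (A B : Matrix (Fin n) (Fin n) ℝ) :
    opnorm (A * B) ≤ opnorm A * opnorm B := by
  simpa [opnorm] using norm_mul_le
    (Matrix.toEuclideanCLM (𝕜 := ℝ) A) (Matrix.toEuclideanCLM (𝕜 := ℝ) B)

lemma opnorm_one {n : ℕ} [NeZero n] : opnorm (1 : Matrix (Fin n) (Fin n) ℝ) = 1 := by
  simp [opnorm]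

lemma vnorm_mulVec_le {n : ℕ} (A : Matrix (Fin n) (Fin n) ℝ) (v : Fin n → ℝ) :
    vnorm (A *ᵥ v) ≤ opnorm A * vnorm v :=
  (Matrix.toEuclideanCLM (𝕜 := ℝ) A).le_opNorm (WithLp.toLp 2 v)

/-- Forward error bound for a perturbed linear system `(B + E + F) y = c'` against `B x = c`. -/
lemma vnorm_sub_le_of_perturbed_system {n : ℕ} {B E F : Matrix (Fin n) (Fin n) ℝ}
    (hB : IsUnit B) {x y c c' : Fin n → ℝ} (hx : B *ᵥ x = c) (hy : (B + E + F) *ᵥ y = c')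
    (hδ : (opnorm E + opnorm F) * opnorm B⁻¹ < 1) :
    vnorm (y - x) ≤ opnorm B⁻¹ * (vnorm (c' - c) + (opnorm E + opnorm F) * vnorm x) /
      (1 - (opnorm E + opnorm F) * opnorm B⁻¹) := by
  have hdet : IsUnit B.det := (Matrix.isUnit_iff_isUnit_det B).mp hB
  have hres : B *ᵥ (y - x) = (c' - c) - (E + F) *ᵥ y := by
    rw [← hx, ← hy, Matrix.mulVec_sub, add_assoc, Matrix.add_mulVec B]
    abel
  have hsol : y - x = B⁻¹ *ᵥ ((c' - c) - (E + F) *ᵥ y) := by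
    rw [← hres, Matrix.mulVec_mulVec, Matrix.nonsing_inv_mul _ hdet, Matrix.one_mulVec]
  have hyx : vnorm y ≤ vnorm x + vnorm (y - x) := by
    simpa using vnorm_add_le x (y - x)
  have hg : 0 ≤ opnorm E + opnorm F := add_nonneg (opnorm_nonneg E) (opnorm_nonneg F)
  have hbound : vnorm (y - x) ≤ opnorm B⁻¹ *
      (vnorm (c' - c) + (opnorm E + opnorm F) * (vnorm x + vnorm (y - x))) := by
    calc vnorm (y - x) = vnorm (B⁻¹ *ᵥ ((c' - c) - (E + F) *ᵥ y)) := congrArg vnorm hsol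
      _ ≤ opnorm B⁻¹ * vnorm ((c' - c) - (E + F) *ᵥ y) := vnorm_mulVec_le _ _
      _ ≤ _ := by
        refine mul_le_mul_of_nonneg_left ?_ (opnorm_nonneg _)
        refine (vnorm_sub_le _ _).trans (add_le_add le_rfl ?_)
        refine (vnorm_mulVec_le _ _).trans ?_
        exact mul_le_mul (opnorm_add_le E F) hyx (vnorm_nonneg _) hg
  rw [le_div_iff₀ (by linarith)]
  linarith

theorem stmt10 {n : ℕ} (M K A : Matrix (Fin n) (Fin n) ℝ)
    (hM : IsUnit M) (hAdef : A = M + K) (hA : IsUnit A)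
    (b : Fin n → ℝ) (hb : b ≠ 0)
    (x : Fin n → ℝ) (hx : x = A⁻¹.mulVec b)
    (B : Matrix (Fin n) (Fin n) ℝ) (hBdef : B = 1 + M⁻¹ * K)
    (c : Fin n → ℝ) (hc : c = M⁻¹.mulVec b)
    (ε : ℝ) (hε : 0 ≤ ε)
    (E : Matrix (Fin n) (Fin n) ℝ)
    (hE : opnorm E ≤ ε * (1 + opnorm M⁻¹ * opnorm K))
    (Bhat : Matrix (Fin n) (Fin n) ℝ) (hBhat : Bhat = B + E)
    (chat : Fin n → ℝ) (hchat : vnorm (chat - c) ≤ ε * opnorm M⁻¹ * vnorm b)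
    (F : Matrix (Fin n) (Fin n) ℝ) (hF : opnorm F ≤ ε * opnorm Bhat)
    (xhat : Fin n → ℝ) (hxhat : (Bhat + F).mulVec xhat = chat)
    (δ : ℝ) (hδ : δ = (opnorm E + opnorm F) * opnorm B⁻¹) (hδ1 : δ < 1) :
    vnorm (xhat - x) ≤
      2 * ε / (1 - δ) * condNum B * (4 + opnorm K * vnorm x / vnorm b) *
        (opnorm A⁻¹ * vnorm b) := by
  have : NeZero n := ⟨by rintro rfl; exact hb (Subsingleton.elim _ _)⟩
  have hMdet : IsUnit M.det := (Matrix.isUnit_iff_isUnit_det M).mp hM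
  have hAdet : IsUnit A.det := (Matrix.isUnit_iff_isUnit_det A).mp hA
  have hBA : B = M⁻¹ * A := by
    rw [hBdef, hAdef, Matrix.mul_add, Matrix.nonsing_inv_mul _ hMdet]
  have hB : IsUnit B := hBA ▸ ((Matrix.isUnit_nonsing_inv_iff).mpr hM).mul hA
  have hBdet : IsUnit B.det := (Matrix.isUnit_iff_isUnit_det B).mp hB
  have hBx : B *ᵥ x = c := by
    rw [hBA, hx, hc, Matrix.mulVec_mulVec, Matrix.mul_assoc, Matrix.mul_nonsing_inv _ hAdet,
      Matrix.mul_one]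
  have herr := vnorm_sub_le_of_perturbed_system hB hBx (hBhat ▸ hxhat) (hδ ▸ hδ1)
  rw [← hδ] at herr
  have hβ : 0 < vnorm b := vnorm_pos hb
  have hξ : vnorm x ≤ opnorm A⁻¹ * vnorm b := hx ▸ vnorm_mulVec_le _ _
  have hm : opnorm M⁻¹ ≤ opnorm B * opnorm A⁻¹ := by
    have hM' : M⁻¹ = B * A⁻¹ := by
      rw [hBA, Matrix.mul_assoc, Matrix.mul_nonsing_inv _ hAdet, Matrix.mul_one]
    exact hM' ▸ opnorm_mul_le B A⁻¹
  have hone : 1 ≤ opnorm B + opnorm M⁻¹ * opnorm K := by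
    have h1 : (1 : Matrix (Fin n) (Fin n) ℝ) = B - M⁻¹ * K := by rw [hBdef]; abel
    calc (1 : ℝ) = opnorm (B - M⁻¹ * K) := by rw [← h1, opnorm_one]
      _ ≤ _ := (opnorm_sub_le _ _).trans (add_le_add le_rfl (opnorm_mul_le _ _))
  have hκ : 1 ≤ opnorm B * opnorm B⁻¹ := by
    have := opnorm_mul_le B B⁻¹
    rwa [Matrix.mul_nonsing_inv _ hBdet, opnorm_one] at this
  have hF' : opnorm F ≤ ε * (2 * opnorm B) := by
    refine hF.trans (mul_le_mul_of_nonneg_left ?_ hε)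
    have hadd : opnorm Bhat ≤ opnorm B + opnorm E := hBhat ▸ opnorm_add_le B E
    have hinv : 0 < opnorm B⁻¹ := by
      refine lt_of_le_of_ne (opnorm_nonneg _) fun h => ?_
      rw [← h] at hκ
      norm_num at hκ
    have hEB : opnorm E ≤ opnorm B := by
      refine le_of_mul_le_mul_right ?_ hinv
      have := mul_nonneg (opnorm_nonneg F) hinv.le
      linarith
    linarith
  have hpos : 0 < 1 - δ := by linarith
  have hrhs : 2 * ε / (1 - δ) * condNum B * (4 + opnorm K * vnorm x / vnorm b) *
        (opnorm A⁻¹ * vnorm b) = opnorm B⁻¹ * (2 * ε * (opnorm B * opnorm A⁻¹) *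
          (4 * vnorm b + opnorm K * vnorm x)) / (1 - δ) := by
    rw [condNum]
    field_simp
  rw [hrhs]
  refine herr.trans ?_
  refine div_le_div_of_nonneg_right (mul_le_mul_of_nonneg_left ?_ (opnorm_nonneg _)) hpos.le
  have hx0 := vnorm_nonneg x
  have hBn := opnorm_nonneg B
  have hkξ : 0 ≤ opnorm K * vnorm x := mul_nonneg (opnorm_nonneg _) hx0
  have hmβ := mul_le_mul_of_nonneg_right hm hβ.le
  have hmkξ := mul_le_mul_of_nonneg_right hm hkξ
  have hBξ := mul_le_mul_of_nonneg_left hξ hBn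
  have honeξ := mul_le_mul_of_nonneg_right hone hx0
  have hBAβ : 0 ≤ opnorm B * opnorm A⁻¹ * vnorm b := by
    have := opnorm_nonneg A⁻¹
    positivity
  calc vnorm (chat - c) + (opnorm E + opnorm F) * vnorm x
      ≤ ε * opnorm M⁻¹ * vnorm b +
        (ε * (1 + opnorm M⁻¹ * opnorm K) + ε * (2 * opnorm B)) * vnorm x := by gcongr
    _ = ε * (opnorm M⁻¹ * vnorm b + vnorm x + opnorm M⁻¹ * (opnorm K * vnorm x) +
        2 * (opnorm B * vnorm x)) := by ring
    _ ≤ ε * (2 * (opnorm B * opnorm A⁻¹) * (4 * vnorm b + opnorm K * vnorm x)) :=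
        mul_le_mul_of_nonneg_left (by linarith) hε
    _ = 2 * ε * (opnorm B * opnorm A⁻¹) * (4 * vnorm b + opnorm K * vnorm x) := by ring
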